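/- arXiv:1609.09668 — 2 statements merged into one kernel-verified Lean document; each statement's English description precedes it below -/
import Mathlib

section
/- Let A be an n×n matrix over the split quaternion algebra H. Then for every j, the column determinant expands along the j-th column: cdet_j A = Σ_{i=1}^n L_{ij} · a_{ij}, where the left ij-th cofactor L_{ij} is given as follows. If i ≠ j, then L_{ij} = − cdet_k A^{jj}_{i.}(a_{j.}), where A^{jj}_{i.}(a_{j.}) is the (n−1)×(n−1) matrix obtained from A by replacing the i-th row with the j-th row and then deleting both the j-th row and the j-th column, and k = i if j > i, while k = i−1 if j < i. If i = j, then L_{jj} = cdet_k A^{jj}, where A^{jj} is obtained from A by deleting both the j-th row and the j-th column, and k is the least element of {1,…,n} \ {j}. -/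
/-- The split quaternion (coquaternion) algebra over ℝ:
`i² = −1`, `j² = 1`, `k² = 1`, `ij = −ji = k`. -/
abbrev SplitQuaternion : Type := QuaternionAlgebra ℝ (-1) 0 1

noncomputable section

namespace SplitQuaternion

variable {n : ℕ}

/-- The ordered product of entries of `A` along the cycle of `σ` containing `s`,
read in the "row" direction:
`a_{s, σ s} * a_{σ s, σ² s} * ⋯ * a_{σ^{L−1} s, s}` where `L` is the cycle length. -/
def rowCycleProd (A : Matrix (Fin n) (Fin n) SplitQuaternion) (σ : Equiv.Perm (Fin n))
    (s : Fin n) : SplitQuaternion :=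
  ((List.range (Function.minimalPeriod σ s)).map
    (fun m => A ((σ ^ m) s) ((σ ^ (m + 1)) s))).prod

/-- The ordered product of entries of `A` along the cycle of `σ` containing `s`,
read in the "column" direction:
`a_{s, σ^{L−1} s} * ⋯ * a_{σ² s, σ s} * a_{σ s, s}` where `L` is the cycle length. -/
def colCycleProd (A : Matrix (Fin n) (Fin n) SplitQuaternion) (σ : Equiv.Perm (Fin n))
    (s : Fin n) : SplitQuaternion :=
  (((List.range (Function.minimalPeriod σ s)).map
    (fun m => A ((σ ^ (m + 1)) s) ((σ ^ m) s))).reverse).prod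

open scoped Classical in
/-- The least elements of the cycles of `σ` other than the cycle containing `i`,
listed in increasing order. -/
def otherCycleMins (σ : Equiv.Perm (Fin n)) (i : Fin n) : List (Fin n) :=
  (Finset.univ.filter (fun s : Fin n =>
    (∀ t, σ.SameCycle s t → s ≤ t) ∧ ¬ σ.SameCycle i s)).sort (· ≤ ·)

/-- The `i`-th row determinant of `A`: the sum over all permutations `σ` of
`(−1)^{n−r}` (which is `sign σ`, `r` being the number of disjoint cycles of `σ`,
fixed points included) times the product of the entries of `A` ordered according to
the left-ordered cycle notation of `σ` whose first cycle starts with `i`, every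
other cycle starting with its least element, the cycles being ordered by
increasing least elements. -/
def rdet (A : Matrix (Fin n) (Fin n) SplitQuaternion) (i : Fin n) : SplitQuaternion :=
  ∑ σ : Equiv.Perm (Fin n),
    ((Equiv.Perm.sign σ : ℤ) : SplitQuaternion) *
      (rowCycleProd A σ i * ((otherCycleMins σ i).map (rowCycleProd A σ)).prod)

/-- The `j`-th column determinant of `A`: the sum over all permutations `τ` of
`(−1)^{n−r}` times the product of the entries of `A` ordered according to the
right-ordered cycle notation of `τ` whose rightmost cycle ends with `j`, every
other cycle ending with its least element, the cycles being ordered (from right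
to left) by increasing least elements. -/
def cdet (A : Matrix (Fin n) (Fin n) SplitQuaternion) (j : Fin n) : SplitQuaternion :=
  ∑ σ : Equiv.Perm (Fin n),
    ((Equiv.Perm.sign σ : ℤ) : SplitQuaternion) *
      ((((otherCycleMins σ j).reverse).map (colCycleProd A σ)).prod * colCycleProd A σ j)

/-- The determinant of a Hermitian matrix: the common value of all row and column
determinants (here given as `rdet` at the index `0`). -/
def hdet [NeZero n] (A : Matrix (Fin n) (Fin n) SplitQuaternion) : SplitQuaternion :=
  rdet A 0


/-- The right `ij`-th cofactor of `A`: for `i ≠ j` it is `− rdet_k A^{ii}_{.j}(a_{.i})`,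
where `A^{ii}_{.j}(a_{.i})` is obtained from `A` by replacing the `j`-th column with the
`i`-th column and deleting both the `i`-th row and column, and `k = j` if `i > j` while
`k = j − 1` if `i < j`; for `i = j` it is `rdet_k A^{ii}` where `k` is the least
remaining index (i.e. position `0` of the submatrix). -/
def cofR (A : Matrix (Fin (n + 1)) (Fin (n + 1)) SplitQuaternion) (i j : Fin (n + 1)) :
    SplitQuaternion :=
  if hij : i = j then
    if hn : 0 < n then rdet (A.submatrix i.succAbove i.succAbove) ⟨0, hn⟩ else 1
  else
    - rdet ((A.updateCol j (fun p => A p i)).submatrix i.succAbove i.succAbove)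
        ⟨if (j : ℕ) < (i : ℕ) then (j : ℕ) else (j : ℕ) - 1, by
          have h1 := i.isLt; have h2 := j.isLt
          have h3 : (i : ℕ) ≠ (j : ℕ) := fun h => hij (Fin.ext h)
          split <;> omega⟩

/-- The left `ij`-th cofactor of `A`: for `i ≠ j` it is `− cdet_k A^{jj}_{i.}(a_{j.})`,
where `A^{jj}_{i.}(a_{j.})` is obtained from `A` by replacing the `i`-th row with the
`j`-th row and deleting both the `j`-th row and column, and `k = i` if `j > i` while
`k = i − 1` if `j < i`; for `i = j` it is `cdet_k A^{jj}` where `k` is the least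
remaining index (i.e. position `0` of the submatrix). -/
def cofL (A : Matrix (Fin (n + 1)) (Fin (n + 1)) SplitQuaternion) (i j : Fin (n + 1)) :
    SplitQuaternion :=
  if hij : i = j then
    if hn : 0 < n then cdet (A.submatrix j.succAbove j.succAbove) ⟨0, hn⟩ else 1
  else
    - cdet ((A.updateRow i (fun q => A j q)).submatrix j.succAbove j.succAbove)
        ⟨if (i : ℕ) < (j : ℕ) then (i : ℕ) else (i : ℕ) - 1, by
          have h1 := i.isLt; have h2 := j.isLt
          have h3 : (i : ℕ) ≠ (j : ℕ) := fun h => hij (Fin.ext h)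
          split <;> omega⟩

open Equiv Function

/-- The permutation of `Fin (n + 1)` obtained from a permutation `τ` of `Fin n`, transported along
`j.succAbove`, by making `j` a fixed point (`o = none`) or by inserting `j` into the cycle of `k`
just before `k` (`o = some k`). -/
def insertPerm (j : Fin (n + 1)) (o : Option (Fin n)) (τ : Perm (Fin n)) : Perm (Fin (n + 1)) :=
  (finSuccEquiv' j).symm.permCongr (Perm.decomposeOption.symm (o, τ))

theorem insertPerm_none_self (j : Fin (n + 1)) (τ : Perm (Fin n)) :
    insertPerm j none τ j = j := by
  simp [insertPerm]

theorem insertPerm_some_self (j : Fin (n + 1)) (k : Fin n) (τ : Perm (Fin n)) :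
    insertPerm j (some k) τ j = j.succAbove k := by
  simp [insertPerm]

theorem insertPerm_succAbove_of_eq (j : Fin (n + 1)) {k : Fin n} {τ : Perm (Fin n)} {s : Fin n}
    (h : τ s = k) : insertPerm j (some k) τ (j.succAbove s) = j := by
  simp [insertPerm, h]

theorem insertPerm_succAbove_of_ne (j : Fin (n + 1)) {o : Option (Fin n)} {τ : Perm (Fin n)}
    {s : Fin n} (h : some (τ s) ≠ o) :
    insertPerm j o τ (j.succAbove s) = j.succAbove (τ s) := by
  simp [insertPerm, swap_apply_of_ne_of_ne _ h]

theorem sign_insertPerm_none (j : Fin (n + 1)) (τ : Perm (Fin n)) :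
    Perm.sign (insertPerm j none τ) = Perm.sign τ := by
  simp [insertPerm, -permCongr_symm]

theorem sign_insertPerm_some (j : Fin (n + 1)) (k : Fin n) (τ : Perm (Fin n)) :
    Perm.sign (insertPerm j (some k) τ) = - Perm.sign τ := by
  simp [insertPerm, -permCongr_symm]

theorem sum_perm_eq_sum_insertPerm {M : Type*} [AddCommMonoid M] (j : Fin (n + 1))
    (f : Perm (Fin (n + 1)) → M) :
    ∑ σ, f σ = ∑ τ, f (insertPerm j none τ) + ∑ k, ∑ τ, f (insertPerm j (some k) τ) := by
  rw [← (Perm.decomposeOption.symm.trans (finSuccEquiv' j).symm.permCongr).sum_comp,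
    Fintype.sum_prod_type, Fintype.sum_option]
  rfl

theorem insertPerm_pow_succAbove (j : Fin (n + 1)) {o : Option (Fin n)} {τ : Perm (Fin n)}
    {s : Fin n} {N : ℕ} (h : ∀ m < N, some ((τ ^ (m + 1)) s) ≠ o) :
    (insertPerm j o τ ^ N) (j.succAbove s) = j.succAbove ((τ ^ N) s) := by
  induction N with
  | zero => simp
  | succ N ih =>
    have hN := h N N.lt_succ_self
    rw [pow_succ', Perm.mul_apply] at hN ⊢
    rw [ih fun m hm => h m (hm.trans N.lt_succ_self), insertPerm_succAbove_of_ne j hN,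
      pow_succ' τ, Perm.mul_apply]

theorem insertPerm_pow_succAbove_of_not_sameCycle (j : Fin (n + 1)) {o : Option (Fin n)}
    {τ : Perm (Fin n)} {s : Fin n} (h : ∀ k ∈ o, ¬ τ.SameCycle k s) (N : ℕ) :
    (insertPerm j o τ ^ N) (j.succAbove s) = j.succAbove ((τ ^ N) s) := by
  refine insertPerm_pow_succAbove j fun m _ hm => h _ hm.symm ?_
  exact Perm.SameCycle.symm ⟨(m + 1 : ℕ), by rw [zpow_natCast]⟩

theorem insertPerm_pow_succ_self (j : Fin (n + 1)) {k : Fin n} {τ : Perm (Fin n)} {m : ℕ}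
    (hm : m < minimalPeriod τ k) :
    (insertPerm j (some k) τ ^ (m + 1)) j = j.succAbove ((τ ^ m) k) := by
  rw [pow_succ, Perm.mul_apply, insertPerm_some_self]
  refine insertPerm_pow_succAbove j fun l hl hk => ?_
  refine not_isPeriodicPt_of_pos_of_lt_minimalPeriod (f := τ) (x := k) l.succ_ne_zero (by omega) ?_
  rw [IsPeriodicPt, IsFixedPt, ← Perm.coe_pow]
  exact Option.some_injective _ hk

theorem minimalPeriod_perm_pos (τ : Perm (Fin n)) (k : Fin n) : 0 < minimalPeriod τ k :=
  minimalPeriod_pos_of_mem_periodicPts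
    (mk_mem_periodicPts (orderOf_pos τ) (by
      rw [IsPeriodicPt, IsFixedPt, ← Perm.coe_pow, pow_orderOf_eq_one, Perm.one_apply]))

theorem pow_minimalPeriod_apply (τ : Perm (Fin n)) (k : Fin n) :
    (τ ^ minimalPeriod τ k) k = k := by
  rw [Perm.coe_pow]
  exact iterate_minimalPeriod

theorem insertPerm_pow_minimalPeriod_add_one_self (j : Fin (n + 1)) (k : Fin n)
    (τ : Perm (Fin n)) : (insertPerm j (some k) τ ^ (minimalPeriod τ k + 1)) j = j := by
  obtain ⟨L, hL⟩ := Nat.exists_eq_succ_of_ne_zero (minimalPeriod_perm_pos τ k).ne'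
  have hk := pow_minimalPeriod_apply τ k
  rw [hL, pow_succ', Perm.mul_apply] at hk
  rw [hL, pow_succ', Perm.mul_apply, insertPerm_pow_succ_self j (by omega),
    insertPerm_succAbove_of_eq j hk]

theorem minimalPeriod_insertPerm_some_self (j : Fin (n + 1)) (k : Fin n) (τ : Perm (Fin n)) :
    minimalPeriod (insertPerm j (some k) τ) j = minimalPeriod τ k + 1 := by
  have hp : IsPeriodicPt (insertPerm j (some k) τ) (minimalPeriod τ k + 1) j := by
    rw [IsPeriodicPt, IsFixedPt, ← Perm.coe_pow]
    exact insertPerm_pow_minimalPeriod_add_one_self j k τ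
  refine (hp.minimalPeriod_le (Nat.succ_pos _)).antisymm (not_lt.mp fun hlt => ?_)
  obtain ⟨m, hm⟩ := Nat.exists_eq_succ_of_ne_zero
    (minimalPeriod_perm_pos (insertPerm j (some k) τ) j).ne'
  have h := pow_minimalPeriod_apply (insertPerm j (some k) τ) j
  rw [hm, Nat.succ_eq_add_one, insertPerm_pow_succ_self j (by omega)] at h
  exact Fin.succAbove_ne _ _ h

theorem minimalPeriod_insertPerm_succAbove (j : Fin (n + 1)) {o : Option (Fin n)}
    {τ : Perm (Fin n)} {s : Fin n} (h : ∀ k ∈ o, ¬ τ.SameCycle k s) :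
    minimalPeriod (insertPerm j o τ) (j.succAbove s) = minimalPeriod τ s := by
  refine minimalPeriod_eq_minimalPeriod_iff.mpr fun N => ?_
  rw [IsPeriodicPt, IsPeriodicPt, IsFixedPt, IsFixedPt, ← Perm.coe_pow, ← Perm.coe_pow,
    insertPerm_pow_succAbove_of_not_sameCycle j h, Fin.succAbove_right_inj]

theorem insertPerm_sameCycle_succAbove_iff (j : Fin (n + 1)) {o : Option (Fin n)}
    {τ : Perm (Fin n)} {s : Fin n} (h : ∀ k ∈ o, ¬ τ.SameCycle k s) (x : Fin (n + 1)) :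
    (insertPerm j o τ).SameCycle (j.succAbove s) x ↔
      ∃ t, τ.SameCycle s t ∧ j.succAbove t = x := by
  constructor
  · intro hx
    obtain ⟨N, rfl⟩ := hx.exists_nat_pow_eq
    exact ⟨(τ ^ N) s, ⟨N, by rw [zpow_natCast]⟩,
      (insertPerm_pow_succAbove_of_not_sameCycle j h N).symm⟩
  · rintro ⟨t, ht, rfl⟩
    obtain ⟨N, rfl⟩ := ht.exists_nat_pow_eq
    exact ⟨N, by rw [zpow_natCast, insertPerm_pow_succAbove_of_not_sameCycle j h]⟩

theorem insertPerm_sameCycle_self_succAbove_iff (j : Fin (n + 1)) (o : Option (Fin n))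
    (τ : Perm (Fin n)) (s : Fin n) :
    (insertPerm j o τ).SameCycle j (j.succAbove s) ↔ ∃ k ∈ o, τ.SameCycle k s := by
  constructor
  · intro hs
    by_contra! h
    obtain ⟨t, -, ht⟩ := (insertPerm_sameCycle_succAbove_iff j h j).mp hs.symm
    exact Fin.succAbove_ne _ _ ht
  · rintro ⟨k, rfl, hs⟩
    obtain ⟨N, rfl⟩ := hs.exists_nat_pow_eq
    refine ⟨(N % minimalPeriod τ k + 1 : ℕ), ?_⟩
    rw [zpow_natCast, insertPerm_pow_succ_self j (Nat.mod_lt _ (minimalPeriod_perm_pos τ k)),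
      Perm.coe_pow, Perm.coe_pow, iterate_mod_minimalPeriod_eq]

open scoped Classical in
theorem otherCycleMins_insertPerm (j : Fin (n + 1)) (o : Option (Fin n)) (τ : Perm (Fin n)) :
    otherCycleMins (insertPerm j o τ) j =
      ((Finset.univ.filter fun s : Fin n =>
        (∀ t, τ.SameCycle s t → s ≤ t) ∧ ∀ k ∈ o, ¬ τ.SameCycle k s).sort (· ≤ ·)).map
        j.succAbove := by
  rw [otherCycleMins]
  have hmap := ((Fin.strictMono_succAbove j).strictMonoOn
    (Finset.univ.filter fun s : Fin n =>
      (∀ t, τ.SameCycle s t → s ≤ t) ∧ ∀ k ∈ o, ¬ τ.SameCycle k s)).map_finsetSort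
      (f := j.succAboveEmb)
  refine Eq.trans ?_ hmap.symm
  congr 1
  ext x
  simp only [Finset.mem_filter, Finset.mem_univ, true_and, Finset.mem_map, Fin.coe_succAboveEmb]
  induction x using Fin.succAboveCases j with
  | x => simp [Fin.succAbove_ne, Perm.SameCycle.refl]
  | p s =>
    simp only [insertPerm_sameCycle_self_succAbove_iff, Fin.succAbove_right_inj, exists_eq_right,
      not_exists, not_and]
    refine and_congr_left fun h => ?_
    simp [insertPerm_sameCycle_succAbove_iff j h]

theorem otherCycleMins_insertPerm_some (j : Fin (n + 1)) (k : Fin n) (τ : Perm (Fin n)) :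
    otherCycleMins (insertPerm j (some k) τ) j = (otherCycleMins τ k).map j.succAbove := by
  rw [otherCycleMins_insertPerm, otherCycleMins]
  simp

theorem otherCycleMins_insertPerm_none [NeZero n] (j : Fin (n + 1)) (τ : Perm (Fin n)) :
    otherCycleMins (insertPerm j none τ) j = (0 :: otherCycleMins τ 0).map j.succAbove := by
  classical
  rw [otherCycleMins_insertPerm, otherCycleMins, ← Finset.sort_cons (h₁ := by simp)
    (h₂ := by simp [Perm.SameCycle.refl])]
  congr 2
  ext s
  simp only [Finset.mem_filter, Finset.mem_univ, true_and, Finset.mem_cons, Option.mem_def,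
    reduceCtorEq, false_imp_iff, implies_true, and_true]
  constructor
  · intro h
    by_cases hs : τ.SameCycle 0 s
    · exact Or.inl (nonpos_iff_eq_zero.mp (h 0 hs.symm))
    · exact Or.inr ⟨h, hs⟩
  · rintro (rfl | h)
    · exact fun t _ => Fin.zero_le t
    · exact h.1

theorem colCycleProd_insertPerm_succAbove (A : Matrix (Fin (n + 1)) (Fin (n + 1)) SplitQuaternion)
    (B : Matrix (Fin n) (Fin n) SplitQuaternion) (j : Fin (n + 1)) {o : Option (Fin n)}
    {τ : Perm (Fin n)} {s : Fin n}
    (hB : ∀ a b, some a ≠ o → B a b = A (j.succAbove a) (j.succAbove b))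
    (h : ∀ k ∈ o, ¬ τ.SameCycle k s) :
    colCycleProd A (insertPerm j o τ) (j.succAbove s) = colCycleProd B τ s := by
  rw [colCycleProd, colCycleProd, minimalPeriod_insertPerm_succAbove j h]
  congr 2
  refine List.map_congr_left fun m _ => ?_
  rw [insertPerm_pow_succAbove_of_not_sameCycle j h, insertPerm_pow_succAbove_of_not_sameCycle j h,
    hB]
  exact fun hm => h _ hm.symm (Perm.SameCycle.symm ⟨(m + 1 : ℕ), by rw [zpow_natCast]⟩)

theorem colCycleProd_insertPerm_none_self
    (A : Matrix (Fin (n + 1)) (Fin (n + 1)) SplitQuaternion) (j : Fin (n + 1))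
    (τ : Perm (Fin n)) : colCycleProd A (insertPerm j none τ) j = A j j := by
  have h : minimalPeriod (insertPerm j none τ) j = 1 :=
    minimalPeriod_eq_one_iff_isFixedPt.mpr (insertPerm_none_self j τ)
  simp [colCycleProd, h, insertPerm_none_self]

theorem colCycleProd_insertPerm_some_self
    (A : Matrix (Fin (n + 1)) (Fin (n + 1)) SplitQuaternion)
    (B : Matrix (Fin n) (Fin n) SplitQuaternion) (j : Fin (n + 1)) (k : Fin n) (τ : Perm (Fin n))
    (hB : ∀ a b, a ≠ k → B a b = A (j.succAbove a) (j.succAbove b))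
    (hBk : ∀ b, B k b = A j (j.succAbove b)) :
    colCycleProd A (insertPerm j (some k) τ) j = colCycleProd B τ k * A (j.succAbove k) j := by
  rw [colCycleProd, colCycleProd, minimalPeriod_insertPerm_some_self, List.range_succ_eq_map,
    List.map_cons, List.reverse_cons, List.prod_append, List.prod_singleton, List.map_map]
  congr 1
  · congr 2
    refine List.map_congr_left fun m hm => ?_
    have hm : m < minimalPeriod τ k := List.mem_range.mp hm
    simp only [comp_apply, Nat.succ_eq_add_one]
    rw [insertPerm_pow_succ_self j hm]
    obtain hlt | heq := (Nat.succ_le_of_lt hm).lt_or_eq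
    · rw [insertPerm_pow_succ_self j hlt, hB]
      intro hk
      refine not_isPeriodicPt_of_pos_of_lt_minimalPeriod (f := τ) (x := k) m.succ_ne_zero hlt ?_
      rwa [IsPeriodicPt, IsFixedPt, ← Perm.coe_pow]
    · rw [Nat.succ_eq_add_one] at heq
      rw [heq, insertPerm_pow_minimalPeriod_add_one_self, pow_minimalPeriod_apply, hBk]
  · simp [insertPerm_some_self]

theorem not_sameCycle_of_mem_otherCycleMins {τ : Perm (Fin n)} {k s : Fin n}
    (hs : s ∈ otherCycleMins τ k) : ¬ τ.SameCycle k s := by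
  classical
  rw [otherCycleMins, Finset.mem_sort, Finset.mem_filter] at hs
  exact hs.2.2

theorem sum_insertPerm_none (A : Matrix (Fin (n + 1)) (Fin (n + 1)) SplitQuaternion)
    (j : Fin (n + 1)) :
    ∑ τ, ((Perm.sign (insertPerm j none τ) : ℤ) : SplitQuaternion) *
      ((((otherCycleMins (insertPerm j none τ) j).reverse).map
        (colCycleProd A (insertPerm j none τ))).prod * colCycleProd A (insertPerm j none τ) j) =
      cofL A j j * A j j := by
  rw [cofL, dif_pos rfl]
  split_ifs with hn
  · have : NeZero n := ⟨hn.ne'⟩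
    rw [cdet, Finset.sum_mul]
    refine Finset.sum_congr rfl fun τ _ => ?_
    have hcol (s : Fin n) : colCycleProd A (insertPerm j none τ) (j.succAbove s) =
        colCycleProd (A.submatrix j.succAbove j.succAbove) τ s :=
      colCycleProd_insertPerm_succAbove A _ j (fun _ _ _ => rfl) (by simp)
    have h0 : (⟨0, hn⟩ : Fin n) = 0 := rfl
    simp [h0, sign_insertPerm_none, colCycleProd_insertPerm_none_self,
      otherCycleMins_insertPerm_none, comp_def, hcol, mul_assoc]
  · obtain rfl : n = 0 := by omega
    simp [sign_insertPerm_none, colCycleProd_insertPerm_none_self, otherCycleMins_insertPerm]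

theorem cofL_succAbove (A : Matrix (Fin (n + 1)) (Fin (n + 1)) SplitQuaternion)
    (j : Fin (n + 1)) (k : Fin n) :
    cofL A (j.succAbove k) j =
      - cdet ((A.updateRow (j.succAbove k) (A j)).submatrix j.succAbove j.succAbove) k := by
  rw [cofL, dif_neg (Fin.succAbove_ne j k)]
  congr 2
  apply Fin.ext
  simp only [Fin.succAbove, Fin.lt_def]
  split_ifs <;> simp_all; omega

theorem sum_insertPerm_some (A : Matrix (Fin (n + 1)) (Fin (n + 1)) SplitQuaternion)
    (j : Fin (n + 1)) (k : Fin n) :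
    ∑ τ, ((Perm.sign (insertPerm j (some k) τ) : ℤ) : SplitQuaternion) *
      ((((otherCycleMins (insertPerm j (some k) τ) j).reverse).map
        (colCycleProd A (insertPerm j (some k) τ))).prod *
          colCycleProd A (insertPerm j (some k) τ) j) =
      cofL A (j.succAbove k) j * A (j.succAbove k) j := by
  rw [cofL_succAbove, cdet, ← Finset.sum_neg_distrib, Finset.sum_mul]
  refine Finset.sum_congr rfl fun τ _ => ?_
  set B := (A.updateRow (j.succAbove k) (A j)).submatrix j.succAbove j.succAbove with hBdef
  have hB (a b : Fin n) (ha : a ≠ k) : B a b = A (j.succAbove a) (j.succAbove b) := by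
    simp [hBdef, Matrix.updateRow_apply, ha]
  have hBk (b : Fin n) : B k b = A j (j.succAbove b) := by
    simp [hBdef]
  have hcol : (otherCycleMins τ k).reverse.map
      (colCycleProd A (insertPerm j (some k) τ) ∘ j.succAbove) =
      (otherCycleMins τ k).reverse.map (colCycleProd B τ) :=
    List.map_congr_left fun s hs => colCycleProd_insertPerm_succAbove A B j
      (fun a b ha => hB a b fun hak => ha (congrArg some hak))
      (by simpa using not_sameCycle_of_mem_otherCycleMins (List.mem_reverse.mp hs))
  rw [colCycleProd_insertPerm_some_self A B j k τ hB hBk, otherCycleMins_insertPerm_some,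
    sign_insertPerm_some, ← List.map_reverse, List.map_map, hcol]
  simp [mul_assoc]

/-- The column determinant expands along the `j`-th column by left cofactors:
`cdet_j A = Σ_i L_{ij} · a_{ij}`. -/
theorem cdet_eq_sum_cofL_mul (A : Matrix (Fin (n + 1)) (Fin (n + 1)) SplitQuaternion)
    (j : Fin (n + 1)) :
    cdet A j = ∑ i : Fin (n + 1), cofL A i j * A i j := by
  rw [cdet, sum_perm_eq_sum_insertPerm j, sum_insertPerm_none, Fin.sum_univ_succAbove _ j]
  simp_rw [sum_insertPerm_some]

end SplitQuaternion

end
end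

section
/- If A is a Hermitian n×n matrix over the split quaternion algebra H (that is, A* = A where A* is the conjugate transpose), then all row and all column determinants of A are equal to one another, rdet_1 A = ⋯ = rdet_n A = cdet_1 A = ⋯ = cdet_n A, and this common value is a real number (a real scalar in H). -/
noncomputable section

namespace SplitQuaternion

variable {n : ℕ}

theorem star_list_prod {R : Type*} [Monoid R] [StarMul R] (l : List R) :
    star l.prod = (l.map star).reverse.prod := by
  induction l with
  | nil => simp
  | cons x l ih => simp [ih]

theorem isPeriodicPt_perm_iff (σ : Equiv.Perm (Fin n)) (k : ℕ) (s : Fin n) :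
    Function.IsPeriodicPt σ k s ↔ (σ ^ k) s = s := by
  rw [Equiv.Perm.coe_pow]
  rfl

theorem minimalPeriod_congr {σ τ : Equiv.Perm (Fin n)} {s t : Fin n}
    (h : ∀ k : ℕ, (σ ^ k) s = s ↔ (τ ^ k) t = t) :
    Function.minimalPeriod σ s = Function.minimalPeriod τ t := by
  simp only [← isPeriodicPt_perm_iff] at h
  exact Nat.dvd_antisymm
    (((h _).2 (Function.isPeriodicPt_minimalPeriod τ t)).minimalPeriod_dvd)
    (((h _).1 (Function.isPeriodicPt_minimalPeriod σ s)).minimalPeriod_dvd)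

theorem rowCycleProd_congr (A : Matrix (Fin n) (Fin n) SplitQuaternion)
    {σ τ : Equiv.Perm (Fin n)} {s : Fin n} (h : ∀ k : ℕ, (σ ^ k) s = (τ ^ k) s) :
    rowCycleProd A σ s = rowCycleProd A τ s := by
  have hL : Function.minimalPeriod σ s = Function.minimalPeriod τ s :=
    minimalPeriod_congr fun k => by rw [h k]
  simp only [rowCycleProd, h, hL]

theorem perm_pow_minimalPeriod (σ : Equiv.Perm (Fin n)) (s : Fin n) :
    (σ ^ Function.minimalPeriod σ s) s = s :=
  (isPeriodicPt_perm_iff σ _ s).1 (Function.isPeriodicPt_minimalPeriod σ s)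

theorem star_rowCycleProd {A : Matrix (Fin n) (Fin n) SplitQuaternion} (hA : A.IsHermitian)
    (σ : Equiv.Perm (Fin n)) (s : Fin n) :
    star (rowCycleProd A σ s) = colCycleProd A σ s := by
  rw [rowCycleProd, colCycleProd, star_list_prod, List.map_map]
  congr 3
  funext m
  exact hA.apply _ _

theorem rowCycleProd_inv {A : Matrix (Fin n) (Fin n) SplitQuaternion} (hA : A.IsHermitian)
    (σ : Equiv.Perm (Fin n)) (s : Fin n) :
    rowCycleProd A σ⁻¹ s = star (rowCycleProd A σ s) := by
  have hL : Function.minimalPeriod (σ⁻¹ : Equiv.Perm (Fin n)) s =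
      Function.minimalPeriod σ s :=
    minimalPeriod_congr fun k => by
      rw [inv_pow, Equiv.Perm.inv_eq_iff_eq, eq_comm]
  have hs : ∀ k ≤ Function.minimalPeriod σ s,
      (σ ^ (Function.minimalPeriod σ s - k)) s = (σ⁻¹ ^ k) s := fun k hk => by
    rw [inv_pow, Equiv.Perm.eq_inv_iff_eq, ← Equiv.Perm.mul_apply, ← pow_add,
      Nat.add_sub_cancel' hk, perm_pow_minimalPeriod]
  rw [star_rowCycleProd hA, rowCycleProd, colCycleProd, hL]
  congr 1
  apply List.ext_getElem
  · simp
  · intro k hk _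
    simp only [List.length_map, List.length_range] at hk
    simp only [List.getElem_map, List.getElem_range, List.getElem_reverse, List.length_map,
      List.length_range]
    rw [← hs k hk.le, ← hs (k + 1) hk]
    congr 3 <;> omega

theorem re_mul_comm (x y : SplitQuaternion) : (x * y).re = (y * x).re := by
  simp only [QuaternionAlgebra.re_mul]
  ring

theorem re_rowCycleProd_apply (A : Matrix (Fin n) (Fin n) SplitQuaternion)
    (σ : Equiv.Perm (Fin n)) (s : Fin n) :
    (rowCycleProd A σ (σ s)).re = (rowCycleProd A σ s).re := by
  have hL : Function.minimalPeriod σ (σ s) = Function.minimalPeriod σ s :=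
    minimalPeriod_congr fun k => by
      rw [← Equiv.Perm.mul_apply, ← pow_succ, pow_succ', Equiv.Perm.mul_apply,
        σ.injective.eq_iff]
  obtain ⟨l, hl⟩ := Nat.exists_eq_succ_of_ne_zero
    (Function.minimalPeriod_pos_of_mem_periodicPts
      (σ.injective.mem_periodicPts s)).ne'
  have hp : (σ ^ (l + 1)) s = s := by
    rw [← Nat.succ_eq_add_one, ← hl, perm_pow_minimalPeriod]
  have hp' : (σ ^ (l + 1 + 1)) s = σ s := by
    rw [pow_succ', Equiv.Perm.mul_apply, hp]
  have hshift : ∀ k : ℕ, (σ ^ k) (σ s) = (σ ^ (k + 1)) s := fun k => by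
    rw [pow_succ, Equiv.Perm.mul_apply]
  rw [rowCycleProd, rowCycleProd, hL, hl]
  simp only [hshift]
  rw [List.prod_range_succ, List.prod_range_succ' _ l, re_mul_comm, hp, hp']
  simp

theorem re_rowCycleProd_of_sameCycle (A : Matrix (Fin n) (Fin n) SplitQuaternion)
    {σ : Equiv.Perm (Fin n)} {s t : Fin n} (h : σ.SameCycle s t) :
    (rowCycleProd A σ s).re = (rowCycleProd A σ t).re := by
  obtain ⟨k, rfl⟩ := h.exists_nat_pow_eq
  induction k with
  | zero => rfl
  | succ k ih =>
    rw [pow_succ', Equiv.Perm.mul_apply, re_rowCycleProd_apply]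
    exact ih (Equiv.Perm.sameCycle_pow_right.2 (Equiv.Perm.SameCycle.refl _ _))

theorem exists_cycle_min (σ : Equiv.Perm (Fin n)) (m : Fin n) :
    ∃ s, σ.SameCycle m s ∧ ∀ t, σ.SameCycle s t → s ≤ t := by
  classical
  obtain ⟨s, hs, hmin⟩ := Finset.exists_min_image (Finset.univ.filter (σ.SameCycle m)) id
    ⟨m, by simp [Equiv.Perm.SameCycle.refl]⟩
  simp only [Finset.mem_filter, Finset.mem_univ, true_and, id] at hs hmin
  exact ⟨s, hs, fun t ht => hmin t (hs.trans ht)⟩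

theorem mem_otherCycleMins {σ : Equiv.Perm (Fin n)} {i s : Fin n} :
    s ∈ otherCycleMins σ i ↔ (∀ t, σ.SameCycle s t → s ≤ t) ∧ ¬ σ.SameCycle i s := by
  simp [otherCycleMins]

theorem nodup_otherCycleMins (σ : Equiv.Perm (Fin n)) (i : Fin n) :
    (otherCycleMins σ i).Nodup :=
  Finset.sort_nodup _ _

theorem pairwise_not_sameCycle (σ : Equiv.Perm (Fin n)) (i : Fin n) :
    (i :: otherCycleMins σ i).Pairwise fun s t => ¬ σ.SameCycle s t := by
  refine List.pairwise_cons.2 ⟨fun s hs => (mem_otherCycleMins.1 hs).2, ?_⟩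
  refine List.Pairwise.imp_of_mem (fun {s t} hs ht hne hst => hne ?_)
    (nodup_otherCycleMins σ i)
  exact le_antisymm ((mem_otherCycleMins.1 hs).1 t hst) ((mem_otherCycleMins.1 ht).1 s hst.symm)

/-- Every cycle has exactly one representative in the list `i :: otherCycleMins σ i`. -/
theorem exists_split_cycleReps (σ : Equiv.Perm (Fin n)) (i m : Fin n) :
    ∃ l₁ s l₂, i :: otherCycleMins σ i = l₁ ++ s :: l₂ ∧ σ.SameCycle m s ∧
      (∀ t ∈ l₁, ¬ σ.SameCycle m t) ∧ ∀ t ∈ l₂, ¬ σ.SameCycle m t := by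
  obtain ⟨s, hs, hms⟩ : ∃ s ∈ i :: otherCycleMins σ i, σ.SameCycle m s := by
    by_cases him : σ.SameCycle m i
    · exact ⟨i, List.mem_cons_self, him⟩
    · obtain ⟨s, hms, hmin⟩ := exists_cycle_min σ m
      exact ⟨s, List.mem_cons_of_mem _ (mem_otherCycleMins.2
        ⟨hmin, fun his => him (hms.trans his.symm)⟩), hms⟩
  obtain ⟨l₁, l₂, hl⟩ := List.append_of_mem hs
  have hpw := pairwise_not_sameCycle σ i
  rw [hl, List.pairwise_append, List.pairwise_cons] at hpw
  exact ⟨l₁, s, l₂, hl, hms,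
    fun t ht hmt => hpw.2.2 t ht s List.mem_cons_self (hmt.symm.trans hms),
    fun t ht hmt => hpw.2.1.1 t ht (hms.symm.trans hmt)⟩

open scoped Classical in
/-- The permutation obtained from `σ` by inverting its cycle through `m`. -/
def invertCycle (m : Fin n) (σ : Equiv.Perm (Fin n)) : Equiv.Perm (Fin n) :=
  σ * (σ.cycleOf m)⁻¹ ^ 2

theorem invertCycle_apply_of_sameCycle {m s : Fin n} {σ : Equiv.Perm (Fin n)}
    (h : σ.SameCycle m s) : invertCycle m σ s = σ⁻¹ s := by
  have h' : σ⁻¹.SameCycle m s := Equiv.Perm.sameCycle_inv.2 h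
  have h'' : σ⁻¹.SameCycle m (σ⁻¹ s) := Equiv.Perm.sameCycle_apply_right.2 h'
  simp only [invertCycle, pow_two, Equiv.Perm.mul_apply, Equiv.Perm.cycleOf_inv]
  rw [h'.cycleOf_apply, h''.cycleOf_apply]
  exact σ.apply_symm_apply _

theorem invertCycle_apply_of_not_sameCycle {m s : Fin n} {σ : Equiv.Perm (Fin n)}
    (h : ¬ σ.SameCycle m s) : invertCycle m σ s = σ s := by
  have h' : ¬ σ⁻¹.SameCycle m s := fun h' => h (Equiv.Perm.sameCycle_inv.1 h')
  simp only [invertCycle, pow_two, Equiv.Perm.mul_apply, Equiv.Perm.cycleOf_inv]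
  rw [Equiv.Perm.cycleOf_apply_of_not_sameCycle h', Equiv.Perm.cycleOf_apply_of_not_sameCycle h']

theorem invertCycle_pow_apply_of_sameCycle {m s : Fin n} {σ : Equiv.Perm (Fin n)}
    (h : σ.SameCycle m s) (k : ℕ) : (invertCycle m σ ^ k) s = (σ⁻¹ ^ k) s := by
  induction k with
  | zero => rfl
  | succ k ih =>
    rw [pow_succ', pow_succ', Equiv.Perm.mul_apply, Equiv.Perm.mul_apply, ih]
    refine invertCycle_apply_of_sameCycle ?_
    exact Equiv.Perm.sameCycle_inv.1
      (Equiv.Perm.sameCycle_pow_right.2 (Equiv.Perm.sameCycle_inv.2 h))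

theorem invertCycle_pow_apply_of_not_sameCycle {m s : Fin n} {σ : Equiv.Perm (Fin n)}
    (h : ¬ σ.SameCycle m s) (k : ℕ) : (invertCycle m σ ^ k) s = (σ ^ k) s := by
  induction k with
  | zero => rfl
  | succ k ih =>
    rw [pow_succ', pow_succ', Equiv.Perm.mul_apply, Equiv.Perm.mul_apply, ih]
    exact invertCycle_apply_of_not_sameCycle fun h' => h (Equiv.Perm.sameCycle_pow_right.1 h')

theorem sameCycle_iff_exists_nat_pow {σ : Equiv.Perm (Fin n)} {s t : Fin n} :
    σ.SameCycle s t ↔ ∃ k : ℕ, (σ ^ k) s = t :=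
  ⟨fun h => h.exists_nat_pow_eq, fun ⟨k, hk⟩ => ⟨k, by simpa using hk⟩⟩

theorem sameCycle_invertCycle {m s t : Fin n} {σ : Equiv.Perm (Fin n)} :
    (invertCycle m σ).SameCycle s t ↔ σ.SameCycle s t := by
  by_cases h : σ.SameCycle m s
  · rw [← Equiv.Perm.sameCycle_inv (f := σ)]
    simp only [sameCycle_iff_exists_nat_pow, invertCycle_pow_apply_of_sameCycle h]
  · simp only [sameCycle_iff_exists_nat_pow, invertCycle_pow_apply_of_not_sameCycle h]

theorem invertCycle_involutive (m : Fin n) : Function.Involutive (invertCycle m) := by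
  intro σ
  ext1 s
  by_cases h : σ.SameCycle m s
  · rw [invertCycle_apply_of_sameCycle (sameCycle_invertCycle.2 h), Equiv.Perm.inv_eq_iff_eq,
      invertCycle_apply_of_sameCycle (Equiv.Perm.sameCycle_apply_right.2 h)]
    exact (σ.symm_apply_apply s).symm
  · rw [invertCycle_apply_of_not_sameCycle (mt sameCycle_invertCycle.1 h),
      invertCycle_apply_of_not_sameCycle h]

theorem sign_invertCycle (m : Fin n) (σ : Equiv.Perm (Fin n)) :
    Equiv.Perm.sign (invertCycle m σ) = Equiv.Perm.sign σ := by
  simp [invertCycle]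

theorem otherCycleMins_invertCycle (m : Fin n) (σ : Equiv.Perm (Fin n)) (i : Fin n) :
    otherCycleMins (invertCycle m σ) i = otherCycleMins σ i := by
  simp only [otherCycleMins, sameCycle_invertCycle]

theorem rowCycleProd_invertCycle_of_sameCycle {A : Matrix (Fin n) (Fin n) SplitQuaternion}
    (hA : A.IsHermitian) {σ : Equiv.Perm (Fin n)} {m s : Fin n} (h : σ.SameCycle m s) :
    rowCycleProd A (invertCycle m σ) s = star (rowCycleProd A σ s) := by
  rw [← rowCycleProd_inv hA, rowCycleProd_congr A (invertCycle_pow_apply_of_sameCycle h)]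

theorem rowCycleProd_invertCycle_of_not_sameCycle (A : Matrix (Fin n) (Fin n) SplitQuaternion)
    {σ : Equiv.Perm (Fin n)} {m s : Fin n} (h : ¬ σ.SameCycle m s) :
    rowCycleProd A (invertCycle m σ) s = rowCycleProd A σ s :=
  rowCycleProd_congr A (invertCycle_pow_apply_of_not_sameCycle h)

open scoped Classical in
/-- The cycle product of `σ` at `s`, replaced by its real part if the cycle meets `B`. -/
def partialReCycleProd (A : Matrix (Fin n) (Fin n) SplitQuaternion) (B : Finset (Fin n))
    (σ : Equiv.Perm (Fin n)) (s : Fin n) : SplitQuaternion :=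
  if ∃ b ∈ B, σ.SameCycle b s then ((rowCycleProd A σ s).re : SplitQuaternion)
  else rowCycleProd A σ s

theorem partialReCycleProd_invertCycle_of_not_sameCycle
    (A : Matrix (Fin n) (Fin n) SplitQuaternion) (B : Finset (Fin n))
    {σ : Equiv.Perm (Fin n)} {m s : Fin n} (h : ¬ σ.SameCycle m s) :
    partialReCycleProd A B (invertCycle m σ) s = partialReCycleProd A B σ s := by
  simp only [partialReCycleProd, sameCycle_invertCycle,
    rowCycleProd_invertCycle_of_not_sameCycle A h]

theorem partialReCycleProd_insert_of_not_sameCycle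
    (A : Matrix (Fin n) (Fin n) SplitQuaternion) (B : Finset (Fin n))
    {σ : Equiv.Perm (Fin n)} {m s : Fin n} (h : ¬ σ.SameCycle m s) :
    partialReCycleProd A (insert m B) σ s = partialReCycleProd A B σ s := by
  simp only [partialReCycleProd, Finset.exists_mem_insert, h, false_or]

theorem half_smul_add_star (x : SplitQuaternion) :
    (1 / 2 : ℝ) • (x + star x) = (x.re : SplitQuaternion) := by
  ext <;> simp
  ring

theorem partialReCycleProd_insert_of_sameCycle {A : Matrix (Fin n) (Fin n) SplitQuaternion}
    (hA : A.IsHermitian) (B : Finset (Fin n)) {σ : Equiv.Perm (Fin n)} {m s : Fin n}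
    (h : σ.SameCycle m s) :
    partialReCycleProd A (insert m B) σ s = (1 / 2 : ℝ) •
      (partialReCycleProd A B σ s + partialReCycleProd A B (invertCycle m σ) s) := by
  simp only [partialReCycleProd, Finset.exists_mem_insert, h, true_or, if_true,
    sameCycle_invertCycle, rowCycleProd_invertCycle_of_sameCycle hA h]
  split_ifs
  · rw [← half_smul_add_star (rowCycleProd A σ s)]
    ext <;> simp
    ring
  · rw [half_smul_add_star]

/-- The term of `σ` in the `i`-th row determinant, with the factors of cycles meeting `B`
replaced by their real parts. -/
def partialReTerm (A : Matrix (Fin n) (Fin n) SplitQuaternion) (B : Finset (Fin n)) (i : Fin n)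
    (σ : Equiv.Perm (Fin n)) : SplitQuaternion :=
  ((Equiv.Perm.sign σ : ℤ) : SplitQuaternion) *
    ((i :: otherCycleMins σ i).map (partialReCycleProd A B σ)).prod

theorem partialReTerm_insert {A : Matrix (Fin n) (Fin n) SplitQuaternion}
    (hA : A.IsHermitian) (B : Finset (Fin n)) (i m : Fin n) (σ : Equiv.Perm (Fin n)) :
    partialReTerm A (insert m B) i σ = (1 / 2 : ℝ) •
      (partialReTerm A B i σ + partialReTerm A B i (invertCycle m σ)) := by
  obtain ⟨l₁, s, l₂, hl, hs, h₁, h₂⟩ := exists_split_cycleReps σ i m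
  have hins : ∀ l : List (Fin n), (∀ t ∈ l, ¬ σ.SameCycle m t) →
      l.map (partialReCycleProd A (insert m B) σ) = l.map (partialReCycleProd A B σ) :=
    fun l h => List.map_congr_left fun t ht =>
      partialReCycleProd_insert_of_not_sameCycle A B (h t ht)
  have hinv : ∀ l : List (Fin n), (∀ t ∈ l, ¬ σ.SameCycle m t) →
      l.map (partialReCycleProd A B (invertCycle m σ)) = l.map (partialReCycleProd A B σ) :=
    fun l h => List.map_congr_left fun t ht =>
      partialReCycleProd_invertCycle_of_not_sameCycle A B (h t ht)
  simp only [partialReTerm, sign_invertCycle, otherCycleMins_invertCycle, hl, List.map_append,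
    List.map_cons, List.prod_append, List.prod_cons, hins l₁ h₁, hins l₂ h₂, hinv l₁ h₁,
    hinv l₂ h₂, partialReCycleProd_insert_of_sameCycle hA B hs]
  rw [← mul_add, ← mul_add, ← add_mul]
  simp only [smul_mul_assoc, mul_smul_comm]

theorem rdet_eq_sum_partialReTerm {A : Matrix (Fin n) (Fin n) SplitQuaternion}
    (hA : A.IsHermitian) (i : Fin n) (B : Finset (Fin n)) :
    rdet A i = ∑ σ, partialReTerm A B i σ := by
  induction B using Finset.induction_on with
  | empty =>
    have hempty : ∀ σ, partialReCycleProd A ∅ σ = rowCycleProd A σ := fun σ => by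
      funext s
      simp [partialReCycleProd]
    simp [rdet, partialReTerm, hempty]
  | insert m B _ ih =>
    have hflip : ∑ σ, partialReTerm A B i (invertCycle m σ) = ∑ σ, partialReTerm A B i σ :=
      Equiv.sum_comp (invertCycle_involutive m).toPerm (partialReTerm A B i)
    simp only [partialReTerm_insert hA]
    rw [← Finset.smul_sum, Finset.sum_add_distrib, hflip, ← ih, ← two_smul ℝ, smul_smul]
    norm_num

open scoped Classical in
/-- The least elements of the cycles of a permutation. -/
def cycleMins (σ : Equiv.Perm (Fin n)) : Finset (Fin n) :=
  Finset.univ.filter fun s => ∀ t, σ.SameCycle s t → s ≤ t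

theorem mul_prod_otherCycleMins {M : Type*} [CommMonoid M] {σ : Equiv.Perm (Fin n)}
    {f : Fin n → M} (hf : ∀ s t, σ.SameCycle s t → f s = f t) (i : Fin n) :
    ((i :: otherCycleMins σ i).map f).prod = ∏ s ∈ cycleMins σ, f s := by
  classical
  obtain ⟨c, hic, hc⟩ := exists_cycle_min σ i
  have herase : (otherCycleMins σ i).toFinset = (cycleMins σ).erase c := by
    ext s
    simp only [List.mem_toFinset, mem_otherCycleMins, Finset.mem_erase, cycleMins,
      Finset.mem_filter, Finset.mem_univ, true_and]
    refine ⟨fun ⟨hs, his⟩ => ⟨fun h => his (h ▸ hic), hs⟩, fun ⟨hne, hs⟩ => ⟨hs, fun his => ?_⟩⟩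
    have hcs := hic.symm.trans his
    exact hne (le_antisymm (hs c hcs.symm) (hc s hcs))
  rw [List.map_cons, List.prod_cons, ← List.prod_toFinset f (nodup_otherCycleMins σ i), herase,
    hf i c hic, Finset.mul_prod_erase]
  simpa [cycleMins] using hc

theorem rdet_eq_coe {A : Matrix (Fin n) (Fin n) SplitQuaternion} (hA : A.IsHermitian)
    (i : Fin n) :
    rdet A i = ((∑ σ : Equiv.Perm (Fin n), ((Equiv.Perm.sign σ : ℤ) : ℝ) *
      ∏ s ∈ cycleMins σ, (rowCycleProd A σ s).re : ℝ) : SplitQuaternion) := by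
  rw [rdet_eq_sum_partialReTerm hA i Finset.univ, ← QuaternionAlgebra.coe_algebraMap, map_sum]
  refine Finset.sum_congr rfl fun σ _ => ?_
  rw [map_mul, map_intCast, partialReTerm,
    ← mul_prod_otherCycleMins (fun s t h => re_rowCycleProd_of_sameCycle A h) i, map_list_prod,
    List.map_map]
  congr 3
  funext s
  exact if_pos ⟨s, Finset.mem_univ s, Equiv.Perm.SameCycle.refl _ _⟩

theorem cdet_eq_star_rdet {A : Matrix (Fin n) (Fin n) SplitQuaternion} (hA : A.IsHermitian)
    (j : Fin n) : cdet A j = star (rdet A j) := by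
  rw [cdet, rdet, star_sum]
  refine Finset.sum_congr rfl fun σ _ => ?_
  rw [star_mul, star_mul, star_intCast, star_rowCycleProd hA, star_list_prod, List.map_map,
    ← List.map_reverse, ← (Int.cast_commute _ _).eq]
  congr 4
  funext s
  exact (star_rowCycleProd hA σ s).symm

/-- For a Hermitian matrix `A` all row determinants and all column determinants
are equal to one another, and this common value is a real scalar. -/
theorem rdet_cdet_eq_and_real_of_isHermitian (A : Matrix (Fin n) (Fin n) SplitQuaternion)
    (hA : A.IsHermitian) :
    (∀ i j : Fin n, rdet A i = rdet A j) ∧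
    (∀ i j : Fin n, cdet A i = cdet A j) ∧
    (∀ i j : Fin n, rdet A i = cdet A j) ∧
    (∀ i : Fin n, ∃ r : ℝ, rdet A i = (r : SplitQuaternion)) := by
  have hc : ∀ i j : Fin n, rdet A i = cdet A j := fun i j => by
    rw [cdet_eq_star_rdet hA, rdet_eq_coe hA, rdet_eq_coe hA, QuaternionAlgebra.star_coe]
  exact ⟨fun i j => (hc i j).trans (hc j j).symm, fun i j => (hc i i).symm.trans (hc i j), hc,
    fun i => ⟨_, rdet_eq_coe hA i⟩⟩

end SplitQuaternion

end
end
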